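/- Let 0 < r < t and ε > 0, and set δ = (t − r)·ε/(2r) > 0. Then for every n ≥ 1, every finite simple graph G = (V,E) on n vertices, and every balanced load allocation θ of G, the following holds. Let U_t = {x ∈ V : ∂θ(x) ≥ 1/t} and U_r = {x ∈ V : ∂θ(x) ≥ 1/r}. Then every W ⊆ V satisfying f_t(W ∪ U_t) ≤ f_t(W) + δn also satisfies |U_r \ W| ≤ εn. -/

import Mathlib

open scoped Classical

noncomputable section

/-- A load allocation of a simple graph `G`: a function `θ` assigning to each ordered pair
`(x,y)` with `{x,y}` an edge a number in `[0,1]`, with `θ x y + θ y x = 1` on edges. -/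
def IsLoadAllocation {V : Type*} (G : SimpleGraph V) (θ : V → V → ℝ) : Prop :=
  (∀ ⦃x y⦄, G.Adj x y → 0 ≤ θ x y ∧ θ x y ≤ 1) ∧
    ∀ ⦃x y⦄, G.Adj x y → θ x y + θ y x = 1

/-- The load of a vertex `x`: `∂θ(x) = Σ_{y ~ x} θ(y → x)`. -/
def load {V : Type*} [Fintype V] (G : SimpleGraph V) (θ : V → V → ℝ) (x : V) : ℝ :=
  ∑ y : V, if G.Adj x y then θ y x else 0

/-- A load allocation is balanced if `∂θ(x) < ∂θ(y)` implies `θ(x → y) = 0` for edges `{x,y}`. -/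
def IsBalanced {V : Type*} [Fintype V] (G : SimpleGraph V) (θ : V → V → ℝ) : Prop :=
  ∀ ⦃x y⦄, G.Adj x y → load G θ x < load G θ y → θ x y = 0

/-- The number of edges of `G` with both endpoints in `U`. -/
def edgesIn {V : Type*} (G : SimpleGraph V) (U : Set V) : ℕ :=
  {e ∈ G.edgeSet | ∀ v ∈ e, v ∈ U}.ncard

/-- `f_t(U) = t·|E(U)| − |U|`. -/
def fW {V : Type*} (G : SimpleGraph V) (t : ℝ) (U : Set V) : ℝ :=
  t * (edgesIn G U) - U.ncard
theorem edgesIn_eq_sum {V : Type*} [Fintype V] (G : SimpleGraph V) (θ : V → V → ℝ)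
    (hθ : IsLoadAllocation G θ) (S : Set V) :
    (edgesIn G S : ℝ) = ∑ x : V, ∑ y : V, if G.Adj x y ∧ x ∈ S ∧ y ∈ S then θ y x else 0 := by
  let H : SimpleGraph V :=
    { Adj := fun x y => G.Adj x y ∧ x ∈ S ∧ y ∈ S
      symm := ⟨fun x y h => ⟨h.1.symm, h.2.2, h.2.1⟩⟩
      loopless := ⟨fun x h => G.loopless.irrefl x h.1⟩ }
  have hE : edgesIn G S = H.edgeFinset.card := by
    unfold edgesIn
    rw [← Set.ncard_coe_finset, SimpleGraph.coe_edgeFinset]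
    congr 1
    ext e
    induction e using Sym2.ind with
    | _ x y => simp [H]
  have h2 : (2 * edgesIn G S : ℝ) = ∑ x : V, ∑ y : V, if H.Adj x y then (1 : ℝ) else 0 := by
    have h := H.sum_degrees_eq_twice_card_edges
    rw [← hE] at h
    have h' : ((∑ v : V, H.degree v : ℕ) : ℝ) = 2 * edgesIn G S := by
      rw [h]; push_cast; ring
    rw [← h']
    push_cast
    refine Finset.sum_congr rfl fun x _ => ?_
    rw [Finset.sum_boole, ← SimpleGraph.card_neighborFinset_eq_degree,
      SimpleGraph.neighborFinset_eq_filter]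
  have h3 : (∑ x : V, ∑ y : V, if H.Adj x y then (1 : ℝ) else 0)
      = (∑ x : V, ∑ y : V, if H.Adj x y then θ y x else 0)
        + ∑ x : V, ∑ y : V, if H.Adj x y then θ x y else 0 := by
    simp only [← Finset.sum_add_distrib]
    refine Finset.sum_congr rfl fun x _ => Finset.sum_congr rfl fun y _ => ?_
    split_ifs with h
    · have := hθ.2 h.1
      linarith
    · simp
  have h4 : (∑ x : V, ∑ y : V, if H.Adj x y then θ x y else 0)
      = ∑ x : V, ∑ y : V, if H.Adj x y then θ y x else 0 := by
    rw [Finset.sum_comm]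
    simp only [H.adj_comm]
  have h5 : (edgesIn G S : ℝ) = ∑ x : V, ∑ y : V, if H.Adj x y then θ y x else 0 := by
    linarith
  exact h5

/-- Stability of the variational characterization: with `δ = (t−r)·ε/(2r)` (depending only on
`t, r, ε`), for every graph on `n` vertices and balanced load allocation `θ`, any near
maximizer `W` of `f_t` (in the sense `f_t(W ∪ U_t) ≤ f_t(W) + δn`) misses at most `εn`
vertices of `U_r = {x : ∂θ(x) ≥ 1/r}`. -/
theorem balanced_load_stability
    (r t ε : ℝ) (hr : 0 < r) (hrt : r < t) (hε : 0 < ε)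
    (n : ℕ) (hn : 1 ≤ n) {V : Type*} [Fintype V] (hcard : Fintype.card V = n)
    (G : SimpleGraph V) (θ : V → V → ℝ)
    (hθ : IsLoadAllocation G θ) (hbal : IsBalanced G θ)
    (W : Set V)
    (hW : fW G t (W ∪ {x | 1 / t ≤ load G θ x}) ≤
      fW G t W + ((t - r) * ε / (2 * r)) * n) :
    (({x | 1 / r ≤ load G θ x} \ W).ncard : ℝ) ≤ ε * n := by
  have ht : 0 < t := hr.trans hrt
  set U : Set V := {x | 1 / t ≤ load G θ x} with hU
  set R : Set V := {x | 1 / r ≤ load G θ x} with hR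
  have hRU : R ⊆ U := fun x hx => (one_div_le_one_div_of_le hr hrt.le).trans hx
  have key : (∑ x : V, if x ∈ U \ W then load G θ x else 0) ≤
      (edgesIn G (W ∪ U) : ℝ) - edgesIn G W := by
    rw [edgesIn_eq_sum G θ hθ, edgesIn_eq_sum G θ hθ, ← Finset.sum_sub_distrib]
    refine Finset.sum_le_sum fun x _ => ?_
    rw [← Finset.sum_sub_distrib]
    by_cases hx : x ∈ U \ W
    · rw [if_pos hx, load]
      refine Finset.sum_le_sum fun y _ => ?_
      by_cases ha : G.Adj x y
      · by_cases hy : y ∈ W ∪ U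
        · simp [ha, hy, hx.1, hx.2]
        · have hyU : ¬ (1 / t ≤ load G θ y) := fun h => hy (Or.inr h)
          have h0 : θ y x = 0 := hbal ha.symm ((not_le.mp hyU).trans_le hx.1)
          simp [h0]
      · simp [ha]
    · rw [if_neg hx]
      refine Finset.sum_nonneg fun y _ => ?_
      by_cases ha : G.Adj x y
      · have h0 := (hθ.1 ha.symm).1
        by_cases h1 : x ∈ W ∧ y ∈ W
        · simp [ha, h1.1, h1.2]
        · simp only [ha, true_and, if_neg h1]
          split_ifs <;> simp [h0]
      · simp [ha]
  have hnc : ∀ S : Set V, (S.ncard : ℝ) = ∑ x : V, if x ∈ S then (1 : ℝ) else 0 := by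
    intro S
    rw [Finset.sum_boole, ← Set.ncard_coe_finset]
    simp
  have hcu : ((W ∪ U).ncard : ℝ) = W.ncard + (U \ W).ncard := by
    rw [← Set.union_diff_self, Set.ncard_union_eq Set.disjoint_sdiff_right]
    push_cast; rfl
  have hsum : (t / r - 1) * ((R \ W).ncard : ℝ) ≤
      t * (∑ x : V, if x ∈ U \ W then load G θ x else 0) - (U \ W).ncard := by
    rw [hnc, hnc, Finset.mul_sum, Finset.mul_sum, ← Finset.sum_sub_distrib]
    refine Finset.sum_le_sum fun x _ => ?_
    by_cases hx : x ∈ U \ W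
    · have hx1 : 1 / t ≤ load G θ x := hx.1
      have h1 : 1 ≤ t * load G θ x := by
        rw [div_le_iff₀ ht] at hx1; linarith
      by_cases hxR : x ∈ R \ W
      · have hx2 : 1 / r ≤ load G θ x := hxR.1
        rw [if_pos hx, if_pos hx, if_pos hxR]
        have := mul_le_mul_of_nonneg_left hx2 ht.le
        rw [mul_one_div] at this
        linarith
      · rw [if_pos hx, if_pos hx, if_neg hxR]
        linarith
    · have hxR : x ∉ R \ W := fun h => hx ⟨hRU h.1, h.2⟩
      rw [if_neg hx, if_neg hx, if_neg hxR]
      simp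
  have hkt := mul_le_mul_of_nonneg_left key ht.le
  unfold fW at hW
  rw [hcu] at hW
  have hfin : (t / r - 1) * ((R \ W).ncard : ℝ) ≤ (t - r) * ε / (2 * r) * n := by linarith
  have e1 : (t / r - 1) = (t - r) / r := by field_simp
  have e2 : (t - r) * ε / (2 * r) * n = (t - r) / r * (ε * n / 2) := by field_simp
  rw [e1, e2] at hfin
  have hpos : 0 < (t - r) / r := div_pos (by linarith) hr
  have := le_of_mul_le_mul_left hfin hpos
  have : 0 ≤ ε * n := by positivity
  linarith
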